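/- Given p > 1 and ε > 0, there exist two trigonometric polynomials P and γ with integer spectrum (hence 1-periodic) such that: (1) γ(t) > 0 for all t ∈ 𝕋; (2) γ̂(0) = 1 and γ̂(n) ≥ 0 for all n ∈ ℤ; (3) ‖γ − 1‖_{A^p(𝕋)} < ε; (4) P̂(−n) = 0 for n = 0, 1, 2, …; (5) ‖P·γ − 1‖_{A^p(𝕋)} < ε. -/

import Mathlib

/-- The trigonometric polynomial with integer spectrum whose Fourier coefficients are
given by the finitely supported function `c : ℤ →₀ ℂ`:
`t ↦ Σ_n c(n) e^{2πint}`. -/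
noncomputable def trigPolyZ (c : ℤ →₀ ℂ) : ℝ → ℂ :=
  fun t => c.sum fun n z => z * Complex.exp (2 * Real.pi * Complex.I * n * t)

/-- The `A^p(𝕋)` norm of the trigonometric polynomial with Fourier coefficients
`c : ℤ →₀ ℂ`: the `ℓ^p` norm of the coefficient sequence. -/
noncomputable def apNormZ (p : ℝ) (c : ℤ →₀ ℂ) : ℝ :=
  (c.sum fun _ z => ‖z‖ ^ p) ^ (1 / p)

open MeasureTheory AddCircle

/-- Decay of Fourier coefficients of a Lipschitz function. -/
lemma fc_decay (F : UnitAddCircle → ℂ) (hF : Continuous F) (L : ℝ)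
    (hL : ∀ x y, ‖F x - F y‖ ≤ L * ‖x - y‖) (n : ℤ) (hn : n ≠ 0) :
    ‖fourierCoeff F n‖ ≤ L / |(n:ℝ)| := by
  have hL0 : 0 ≤ L := by
    have h1 := hL ((1/2 : ℝ) : UnitAddCircle) 0
    have h2 : ‖(((1/2 : ℝ) : UnitAddCircle)) - 0‖ = 1/2 := by
      rw [sub_zero, (AddCircle.norm_coe_eq_abs_iff 1 one_ne_zero).2 (by norm_num [abs_of_pos])]
      norm_num
    rw [h2] at h1
    linarith [norm_nonneg (F ((1/2 : ℝ) : UnitAddCircle) - F 0)]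
  set h : UnitAddCircle := ((1 / 2 / (n:ℝ) : ℝ) : UnitAddCircle) with hh
  have key : fourierCoeff F n = - ∫ t, fourier (-n) t • F (t + -h) ∂haarAddCircle := by
    rw [fourierCoeff, ← integral_add_right_eq_self _ (-h), ← integral_neg]
    congr 1
    ext t
    have := fourier_add_half_inv_index (T := 1) (n := -n) (neg_ne_zero.2 hn) one_pos t
    have h3 : ((1 / 2 / ((-n : ℤ):ℝ) : ℝ) : UnitAddCircle) = -h := by
      rw [hh, ← AddCircle.coe_neg]; congr 1; push_cast; rw [div_neg]
    rw [h3] at this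
    rw [this, neg_smul]
  have i1 : Integrable (fun t => fourier (-n) t • F t) (haarAddCircle (T := 1)) :=
    ((fourier (-n)).continuous.smul hF).integrable_of_hasCompactSupport
      (HasCompactSupport.of_compactSpace _)
  have i2 : Integrable (fun t => fourier (-n) t • F (t + -h)) (haarAddCircle (T := 1)) :=
    ((fourier (-n)).continuous.smul (hF.comp (continuous_add_const _))).integrable_of_hasCompactSupport
      (HasCompactSupport.of_compactSpace _)
  have key2 : 2 * fourierCoeff F n
      = ∫ t, (fourier (-n) t • F t - fourier (-n) t • F (t + -h)) ∂haarAddCircle := by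
    rw [integral_sub i1 i2, two_mul]
    nth_rewrite 2 [key]
    rw [fourierCoeff]; ring
  have hnorm : ‖h‖ ≤ 1 / |(n:ℝ)| := by
    have h1 : (1:ℝ) ≤ |(n:ℝ)| := by exact_mod_cast Int.one_le_abs hn
    have e : |1 / 2 / (n:ℝ)| = 1 / 2 / |(n:ℝ)| := by rw [abs_div]; norm_num
    rw [hh, (AddCircle.norm_coe_eq_abs_iff 1 one_ne_zero).2 ?_, e]
    · gcongr; norm_num
    · rw [e, abs_one]
      exact div_le_self (by norm_num) h1
  have b : ‖2 * fourierCoeff F n‖ ≤ L / |(n:ℝ)| := by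
    rw [key2]
    refine (norm_integral_le_of_norm_le_const (C := L / |(n:ℝ)|) ?_).trans ?_
    · refine Filter.Eventually.of_forall fun t => ?_
      rw [← smul_sub, norm_smul]
      have : ‖(fourier (-n) t : ℂ)‖ = 1 := by
        rw [fourier_apply]; exact Circle.norm_coe _
      rw [this, one_mul]
      refine (hL _ _).trans ?_
      have : t - (t + -h) = h := by abel
      rw [this, div_eq_mul_one_div]
      gcongr
    · simp
  rw [norm_mul] at b
  norm_num at b
  linarith [norm_nonneg (fourierCoeff F n)]

lemma fc_bound (F : UnitAddCircle → ℂ) (M : ℝ) (hM : ∀ x, ‖F x‖ ≤ M) (n : ℤ) :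
    ‖fourierCoeff F n‖ ≤ M := by
  rw [fourierCoeff]
  refine (norm_integral_le_of_norm_le_const (C := M) ?_).trans (by simp)
  refine Filter.Eventually.of_forall fun t => ?_
  have : ‖(fourier (-n) t : ℂ)‖ = 1 := by
        rw [fourier_apply]; exact Circle.norm_coe _
  rw [norm_smul, this, one_mul]
  exact hM t

lemma fc_shift (F : UnitAddCircle → ℂ) (a : UnitAddCircle) (n : ℤ) :
    fourierCoeff (fun x => F (x - a)) n = fourier (-n) a * fourierCoeff F n := by
  rw [fourierCoeff, fourierCoeff, ← integral_add_right_eq_self _ a, ← integral_const_mul]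
  congr 1
  ext t
  simp [fourier_apply, smul_add, AddCircle.toCircle_add]
  ring

lemma fc_mul_fourier (F : UnitAddCircle → ℂ) (k n : ℤ) :
    fourierCoeff (fun x => fourier k x * F x) n = fourierCoeff F (n - k) := by
  rw [fourierCoeff, fourierCoeff]
  congr 1
  ext t
  have : -(n-k) = -n + k := by ring
  rw [this, fourier_add]
  simp [mul_assoc]

/-- Triangle function. -/
noncomputable def tri (w : ℝ) (x : UnitAddCircle) : ℝ := max 0 (1 - ‖x‖ / w)

noncomputable def triC (w : ℝ) (n : ℤ) : ℝ :=
  if n = 0 then w else (1 - Real.cos (2 * Real.pi * n * w)) / (2 * Real.pi ^ 2 * n ^ 2 * w)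

lemma tri_cont (w : ℝ) : Continuous (tri w) := by unfold tri; fun_prop

lemma tri_lip (w : ℝ) (hw : 0 < w) (x y : UnitAddCircle) :
    |tri w x - tri w y| ≤ (1 / w) * ‖x - y‖ := by
  unfold tri
  refine (abs_max_sub_max_le_max _ _ _ _).trans ?_
  have : (1 - ‖x‖ / w - (1 - ‖y‖ / w)) = (1/w) * (‖y‖ - ‖x‖) := by ring
  rw [this, abs_mul, abs_of_pos (by positivity : 0 < 1 / w)]
  simp only [sub_self, abs_zero]
  refine max_le (by positivity) ?_
  gcongr
  rw [norm_sub_rev]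
  exact abs_norm_sub_norm_le _ _

lemma tri_int (w : ℝ) (hw : 0 < w) (n : ℤ) :
    ∫ t in (0:ℝ)..w, 2 * Real.cos (2 * Real.pi * n * t) * (1 - t / w) = triC w n := by
  unfold triC
  split_ifs with h
  · subst h
    have hd : ∀ t ∈ Set.uIcc 0 w, HasDerivAt (fun t : ℝ => 2 * t - t ^ 2 / w)
        (2 * Real.cos (2 * Real.pi * ((0:ℤ):ℝ) * t) * (1 - t / w)) t := by
      intro t _
      have := ((hasDerivAt_id t).const_mul 2).sub (((hasDerivAt_id t).pow 2).div_const w)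
      convert! this using 1
      simp; ring
    rw [intervalIntegral.integral_eq_sub_of_hasDerivAt hd
      (Continuous.intervalIntegrable (by fun_prop) _ _)]
    field_simp; ring
  · have hn : (n:ℝ) ≠ 0 := by exact_mod_cast h
    have hpi := Real.pi_ne_zero
    set a : ℝ := 2 * Real.pi * n with ha
    have ha0 : a ≠ 0 := by positivity
    have hd : ∀ t ∈ Set.uIcc 0 w, HasDerivAt
        (fun t : ℝ => 2 * ((1 - t / w) * (Real.sin (a * t) / a)) - 2 * (Real.cos (a * t) / (a ^ 2 * w)))
        (2 * Real.cos (a * t) * (1 - t / w)) t := by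
      intro t _
      have h1 := ((hasDerivAt_id t).const_mul a).sin.div_const a
      have h2 := ((hasDerivAt_id t).const_mul a).cos.div_const (a^2*w)
      have h3 := ((hasDerivAt_id t).div_const w).const_sub 1
      have := ((h3.mul h1).const_mul 2).sub (h2.const_mul 2)
      convert! this using 1
      simp
      field_simp
      ring
    rw [intervalIntegral.integral_eq_sub_of_hasDerivAt hd
      (Continuous.intervalIntegrable (by fun_prop) _ _)]
    simp
    rw [ha] at ha0 ⊢
    field_simp
    ring

lemma tri_fc (w : ℝ) (hw : 0 < w) (hw2 : w ≤ 1/2) (n : ℤ) :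
    fourierCoeff (fun x => (tri w x : ℂ)) n = (triC w n : ℂ) := by
  have hv : ∀ t : ℝ, 0 ≤ t → t ≤ 1/2 → tri w (t : UnitAddCircle) = max 0 (1 - t / w) ∧
      tri w ((-t : ℝ) : UnitAddCircle) = max 0 (1 - t / w) := by
    intro t h0 h1
    have : ‖(t : UnitAddCircle)‖ = t := by
      rw [(AddCircle.norm_coe_eq_abs_iff 1 one_ne_zero).2 (by rw [abs_of_nonneg h0]; simpa using h1),
        abs_of_nonneg h0]
    unfold tri
    rw [AddCircle.coe_neg, norm_neg, this]
    simp
  rw [fourierCoeff_eq_intervalIntegral _ _ (-(1/2))]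
  have hc : Continuous fun x : ℝ => (fourier (-n) (x : UnitAddCircle) : ℂ) • ((tri w (x : UnitAddCircle) : ℝ) : ℂ) := by
    have h1 := tri_cont w
    have : Continuous fun x : ℝ => (x : UnitAddCircle) := AddCircle.continuous_mk' 1
    fun_prop
  have hi : ∀ a b, IntervalIntegrable (fun x : ℝ => (fourier (-n) (x : UnitAddCircle) : ℂ) • ((tri w (x : UnitAddCircle) : ℝ) : ℂ)) volume a b :=
    fun a b => hc.intervalIntegrable a b
  have e1 : (-(1/2) + 1 : ℝ) = 1/2 := by norm_num
  rw [e1, ← intervalIntegral.integral_add_adjacent_intervals (hi _ 0) (hi 0 _)]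
  have e2 := intervalIntegral.integral_comp_neg (a := 0) (b := 1/2) (fun x : ℝ => (fourier (-n) (x : UnitAddCircle) : ℂ) • ((tri w (x : UnitAddCircle) : ℝ) : ℂ))
  rw [neg_zero] at e2
  rw [← e2, ← intervalIntegral.integral_add]
  rotate_left
  · exact (hc.comp continuous_neg).intervalIntegrable _ _
  · exact hi _ _
  have e3 : ∫ x in (0:ℝ)..1/2, ((fourier (-n) ((-x : ℝ) : UnitAddCircle) : ℂ) • ((tri w ((-x : ℝ) : UnitAddCircle) : ℝ) : ℂ) + (fourier (-n) (x : UnitAddCircle) : ℂ) • ((tri w (x : UnitAddCircle) : ℝ) : ℂ))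
      = ∫ x in (0:ℝ)..1/2, ((2 * Real.cos (2 * Real.pi * n * x) * max 0 (1 - x / w) : ℝ) : ℂ) := by
    apply intervalIntegral.integral_congr
    intro x hx
    rw [Set.uIcc_of_le (by norm_num)] at hx
    obtain ⟨h1, h2⟩ := hv x hx.1 hx.2
    simp only [h1, h2, smul_eq_mul, ← add_mul]
    push_cast
    congr 1
    rw [fourier_coe_apply, fourier_coe_apply, Complex.two_cos]
    push_cast
    congr 1 <;> congr 1 <;> ring
  rw [e3, intervalIntegral.integral_ofReal]
  have hc2 : Continuous fun x : ℝ => 2 * Real.cos (2 * Real.pi * n * x) * max 0 (1 - x / w) := by fun_prop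
  rw [← intervalIntegral.integral_add_adjacent_intervals (hc2.intervalIntegrable 0 w) (hc2.intervalIntegrable w _)]
  have e4 : ∫ x in w..1/2, 2 * Real.cos (2 * Real.pi * n * x) * max 0 (1 - x / w) = 0 := by
    rw [← intervalIntegral.integral_zero (a := w) (b := 1/2) (μ := volume)]
    apply intervalIntegral.integral_congr
    intro x hx
    rw [Set.uIcc_of_le hw2] at hx
    have : 1 - x / w ≤ 0 := by
      rw [sub_nonpos, one_le_div hw]; exact hx.1
    simp [max_eq_left this]
  have e5 : ∫ x in (0:ℝ)..w, 2 * Real.cos (2 * Real.pi * n * x) * max 0 (1 - x / w) = triC w n := by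
    rw [← tri_int w hw n]
    apply intervalIntegral.integral_congr
    intro x hx
    rw [Set.uIcc_of_le hw.le] at hx
    have : 0 ≤ 1 - x / w := by
      rw [sub_nonneg, div_le_one hw]; exact hx.2
    simp only [max_eq_right this]
  rw [e4, e5]
  simp

lemma triC_nonneg (w : ℝ) (hw : 0 < w) (n : ℤ) : 0 ≤ triC w n := by
  unfold triC
  split_ifs
  · exact hw.le
  · have := Real.cos_le_one (2 * Real.pi * n * w)
    exact div_nonneg (by linarith) (by positivity)

lemma triC_le (w : ℝ) (hw : 0 < w) (n : ℤ) : triC w n ≤ w := by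
  unfold triC
  split_ifs with h
  · exact le_rfl
  · have hn : (n:ℝ) ≠ 0 := by exact_mod_cast h
    have := Real.one_sub_sq_div_two_le_cos (x := 2 * Real.pi * n * w)
    rw [div_le_iff₀ (by positivity)]
    nlinarith

lemma triC_summable (w : ℝ) (hw : 0 < w) : Summable (triC w) := by
  have h0 : Summable fun n : ℤ => (1 / (n:ℝ)^2) * (1 / (Real.pi^2 * w)) :=
    (Real.summable_one_div_int_pow.2 (by norm_num)).mul_right _
  refine Summable.of_norm_bounded_eventually h0 ?_
  have : ({0} : Set ℤ)ᶜ ∈ (Filter.cofinite : Filter ℤ) := (Set.finite_singleton 0).compl_mem_cofinite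
  filter_upwards [this] with n hn
  have hn : n ≠ 0 := hn
  have hn' : (n:ℝ) ≠ 0 := by exact_mod_cast hn
  rw [Real.norm_of_nonneg (triC_nonneg w hw n)]
  unfold triC
  rw [if_neg hn, div_mul_div_comm, div_le_div_iff₀ (by positivity) (by positivity)]
  have := Real.neg_one_le_cos (2 * Real.pi * n * w)
  have h3 : 0 < (n:ℝ)^2 * (Real.pi^2 * w) := by positivity
  nlinarith

lemma triC_sum (w : ℝ) (hw : 0 < w) (hw2 : w ≤ 1/2) (s : Finset ℤ) : ∑ n ∈ s, triC w n ≤ 1 := by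
  let f : C(UnitAddCircle, ℂ) := ⟨fun x => (tri w x : ℂ), by have := tri_cont w; fun_prop⟩
  have hf : ∀ n, fourierCoeff f n = (triC w n : ℂ) := tri_fc w hw hw2
  have hs : Summable (fourierCoeff f) := by
    have : fourierCoeff f = fun n => (triC w n : ℂ) := funext hf
    rw [this]; exact_mod_cast triC_summable w hw
  have h := has_pointwise_sum_fourier_series_of_summable hs 0
  simp only [hf, fourier_eval_zero, smul_eq_mul, mul_one] at h
  have h1 : f 0 = ((1:ℝ) : ℂ) := by simp [f, tri]
  rw [h1] at h
  have h2 : HasSum (triC w) 1 := by exact_mod_cast h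
  exact sum_le_hasSum s (fun n _ => triC_nonneg w hw n) h2

lemma exists_q (κ : ℝ) (hκ : κ < 1) : ∃ q : Polynomial ℂ, q.coeff 0 = 1 ∧ ∃ ρ : ℝ, 0 ≤ ρ ∧ ρ < 1 ∧
    ∀ z : ℂ, ‖z‖ = 1 → z.re ≤ κ → ‖q.eval z‖ ≤ ρ := by
  obtain ⟨r, hr1, hr2⟩ : ∃ r, max κ 0 < r ∧ r < 1 := exists_between (max_lt hκ one_pos)
  have hrκ : κ < r := (le_max_left _ _).trans_lt hr1
  have hr0 : 0 < r := (le_max_right _ _).trans_lt hr1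
  set c : ℝ := r * (r - κ) / 8 with hc
  have hc0 : 0 < c := by have : 0 < r - κ := by linarith
                         positivity
  obtain ⟨N, hN⟩ : ∃ N : ℕ, r ^ N < c * (1 - r) :=
    exists_pow_lt_of_lt_one (mul_pos hc0 (by linarith)) hr2
  set B : ℝ := 2 / (1 - r) + c with hB
  have h1r : 0 < 1 - r := by linarith
  have hB0 : 0 < B := by positivity
  have hcB : c < B := by rw [hB]; have : 0 < 2 / (1-r) := by positivity
                         linarith
  set η : ℝ := c / B ^ 2 with hη
  have hη0 : 0 < η := by positivity
  let f : Polynomial ℂ := Polynomial.C (r:ℂ) * Polynomial.X *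
    ∑ k ∈ Finset.range N, (Polynomial.C (r:ℂ) * Polynomial.X) ^ k
  refine ⟨1 + Polynomial.C (η:ℂ) * f, ?_, Real.sqrt (1 - c^2 / B^2), Real.sqrt_nonneg _, ?_, ?_⟩
  · simp [f, Polynomial.coeff_zero_eq_eval_zero]
  · rw [Real.sqrt_lt' one_pos]
    have : 0 < c^2/B^2 := by positivity
    linarith
  intro z hz hzκ
  have hfz : f.eval z = r * z * ∑ k ∈ Finset.range N, ((r:ℂ) * z) ^ k := by
    simp [f, Polynomial.eval_finsetSum]
  have hrz : ‖(r:ℂ) * z‖ = r := by rw [norm_mul, hz]; simp [abs_of_pos hr0]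
  have hden : 1 - r ≤ ‖1 - (r:ℂ) * z‖ := by
    have := norm_sub_norm_le (1:ℂ) (r * z)
    rw [hrz, norm_one] at this; exact this
  have hden0 : 1 - (r:ℂ) * z ≠ 0 := by
    intro h; rw [h, norm_zero] at hden; linarith
  set u : ℂ := (r:ℂ) * z with hu
  have hf2 : f.eval z = u / (1 - u) - u * u ^ N / (1 - u) := by
    rw [hfz]
    have := mul_neg_geom_sum u N
    field_simp
    rw [mul_assoc, mul_comm (∑ k ∈ _, _), this]
  have herr : ‖u * u ^ N / (1 - u)‖ ≤ c := by
    rw [norm_div, norm_mul, norm_pow, hrz, div_le_iff₀ (by linarith)]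
    have h1 : r * r ^ N ≤ r^N := by
      have : 0 < r^N := by positivity
      nlinarith
    have h2 : c * (1-r) ≤ c * ‖1 - u‖ := by gcongr
    linarith
  have hzsq : z.re ^ 2 + z.im ^ 2 = 1 := by
    have := Complex.sq_norm z
    rw [hz, Complex.normSq_apply] at this
    nlinarith
  have hn2 : Complex.normSq (1 - u) ≤ 4 := by
    rw [Complex.normSq_eq_norm_sq]
    have : ‖1 - u‖ ≤ 2 := by
      have := norm_sub_le (1:ℂ) u
      rw [hrz, norm_one] at this; linarith
    nlinarith [norm_nonneg (1-u)]
  have hn0 : 0 < Complex.normSq (1 - u) := Complex.normSq_pos.2 hden0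
  have hre : (u / (1 - u)).re ≤ - (2 * c) := by
    have : (u / (1 - u)).re = (r * z.re - r^2) / Complex.normSq (1 - u) := by
      rw [Complex.div_re, ← add_div]
      congr 1
      simp [hu]
      linear_combination -(r^2) * hzsq
    rw [this, div_le_iff₀ hn0]
    have h1 : r * z.re - r^2 ≤ - (8 * c) := by
      rw [hc]; nlinarith
    nlinarith
  have hmain : (f.eval z).re ≤ -c := by
    rw [hf2, Complex.sub_re]
    have := (Complex.abs_re_le_norm (u * u ^ N / (1 - u))).trans herr
    have := (abs_le.1 this).1
    linarith
  have hfB : ‖f.eval z‖ ≤ B := by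
    rw [hf2]
    refine (norm_sub_le _ _).trans ?_
    have : ‖u / (1 - u)‖ ≤ 2 / (1 - r) := by
      rw [norm_div, hrz]
      gcongr
      linarith
    rw [hB]; linarith
  apply Real.le_sqrt_of_sq_le
  rw [← Complex.normSq_eq_norm_sq]
  have hq : (1 + Polynomial.C (η:ℂ) * f).eval z = 1 + η * f.eval z := by simp
  have hfsq : (f.eval z).re^2 + (f.eval z).im^2 ≤ B^2 := by
    have := Complex.sq_norm (f.eval z)
    rw [Complex.normSq_apply] at this
    nlinarith [norm_nonneg (f.eval z)]
  rw [hq, Complex.normSq_apply]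
  simp
  have hηB : η * B^2 = c := by rw [hη]; field_simp
  have : c^2 / B^2 = η * c := by rw [hη]; ring
  rw [this]
  have h5 : η^2 * ((f.eval z).re^2 + (f.eval z).im^2) ≤ η * c := by
    rw [← hηB]
    have := mul_le_mul_of_nonneg_left hfsq (sq_nonneg η)
    linarith
  have h6 := mul_le_mul_of_nonneg_left hmain hη0.le
  nlinarith

lemma poly_lip (q : Polynomial ℂ) : ∃ L : ℝ, 0 ≤ L ∧ ∀ z w : ℂ, ‖z‖ ≤ 1 → ‖w‖ ≤ 1 →
    ‖q.eval z - q.eval w‖ ≤ L * ‖z - w‖ := by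
  obtain ⟨C, hC⟩ := (isCompact_closedBall (0:ℂ) 1).exists_bound_of_continuousOn
    (f := fun z => q.derivative.eval z) (by fun_prop)
  refine ⟨max C 0, le_max_right _ _, fun z w hz hw => ?_⟩
  refine (convex_closedBall (0:ℂ) 1).norm_image_sub_le_of_norm_hasDerivWithin_le
    (f := fun z => q.eval z) (f' := fun z => q.derivative.eval z)
    (fun x _ => (q.hasDerivAt x).hasDerivWithinAt) (fun x hx => (hC x hx).trans (le_max_left _ _))
    (by simpa using hw) (by simpa using hz)

lemma toCircle_lip (x y : UnitAddCircle) :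
    ‖(fourier 1 x : ℂ) - fourier 1 y‖ ≤ 2 * Real.pi * ‖x - y‖ := by
  have h1 : (fourier 1 x : ℂ) = fourier 1 y * fourier 1 (x - y) := by
    simp only [fourier_one]
    rw [← Circle.coe_mul, ← AddCircle.toCircle_add]
    congr 2; abel
  have h2 : ‖(fourier 1 y : ℂ)‖ = 1 := by rw [fourier_apply]; exact Circle.norm_coe _
  have h3 : ∀ d : UnitAddCircle, ‖(fourier 1 d : ℂ) - 1‖ ≤ 2 * Real.pi * ‖d‖ := by
    intro d
    obtain ⟨t, rfl⟩ := QuotientAddGroup.mk_surjective d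
    change ‖(fourier 1 (t : UnitAddCircle) : ℂ) - 1‖ ≤ 2 * Real.pi * ‖(t : UnitAddCircle)‖
    have e : (t : UnitAddCircle) = ((t - round t : ℝ) : UnitAddCircle) := by
      rw [AddCircle.coe_sub]
      have : ((round t : ℝ) : UnitAddCircle) = 0 := by
        rw [AddCircle.coe_eq_zero_iff]; exact ⟨round t, by simp⟩
      rw [this, sub_zero]
    rw [UnitAddCircle.norm_eq, e, fourier_coe_apply]
    have := Real.norm_exp_I_mul_ofReal_sub_one_le (x := 2 * Real.pi * (t - round t))
    have e2 : 2 * (Real.pi:ℂ) * Complex.I * ((1:ℤ):ℂ) * ((t - round t : ℝ):ℂ) / ((1:ℝ):ℂ)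
      = Complex.I * ((2 * Real.pi * (t - round t) : ℝ) : ℂ) := by push_cast; ring
    rw [e2]
    refine this.trans ?_
    rw [Real.norm_eq_abs, abs_mul, abs_of_pos Real.two_pi_pos]
  rw [h1]
  have : (fourier 1 y : ℂ) * fourier 1 (x - y) - fourier 1 y = fourier 1 y * (fourier 1 (x-y) - 1) := by ring
  rw [this, norm_mul, h2, one_mul]
  exact h3 _

lemma exists_kappa (w : ℝ) (hw : 0 < w) : ∃ κ < 1, ∀ y : UnitAddCircle, w ≤ ‖y‖ →
    (fourier 1 y : ℂ).re ≤ κ := by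
  have hK : IsCompact {y : UnitAddCircle | w ≤ ‖y‖} :=
    (isClosed_le continuous_const continuous_norm).isCompact
  by_cases hne : {y : UnitAddCircle | w ≤ ‖y‖}.Nonempty
  · obtain ⟨y0, hy0, hmax⟩ := hK.exists_isMaxOn hne
      (f := fun y => (fourier 1 y : ℂ).re) (by
        have := (fourier (T := 1) 1).continuous
        fun_prop)
    refine ⟨_, ?_, fun y hy => hmax hy⟩
    have hn : ‖(fourier 1 y0 : ℂ)‖ = 1 := by rw [fourier_apply]; exact Circle.norm_coe _
    have h1 : (fourier 1 y0 : ℂ).re ≤ 1 := (Complex.re_le_norm _).trans hn.le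
    refine lt_of_le_of_ne h1 fun h => ?_
    replace h : (fourier 1 y0 : ℂ).re = 1 := h
    have him : (fourier 1 y0 : ℂ).im = 0 := by
      have := Complex.sq_norm (fourier 1 y0 : ℂ)
      rw [hn, Complex.normSq_apply, h] at this
      nlinarith
    have h2 : (fourier 1 y0 : ℂ) = 1 := Complex.ext h him
    have h3 : y0 = 0 := by
      apply AddCircle.injective_toCircle (T := 1) one_ne_zero
      rw [fourier_one] at h2
      ext
      rw [h2]; simp
    have : w ≤ ‖y0‖ := hy0
    rw [h3, norm_zero] at this
    linarith
  · exact ⟨0, one_pos, fun y hy => (hne ⟨y, hy⟩).elim⟩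

lemma pow_sub_le (ρ : ℝ) (a b : ℂ) (ha : ‖a‖ ≤ ρ) (hb : ‖b‖ ≤ ρ) (m : ℕ) :
    ‖a ^ (m+1) - b ^ (m+1)‖ ≤ (m + 1) * ρ ^ m * ‖a - b‖ := by
  have hρ : 0 ≤ ρ := (norm_nonneg _).trans ha
  induction m with
  | zero => simp
  | succ m ih =>
    have : a ^ (m+1+1) - b ^ (m+1+1) = a * (a ^ (m+1) - b ^ (m+1)) + b ^ (m+1) * (a - b) := by ring
    rw [this]
    refine (norm_add_le _ _).trans ?_
    rw [norm_mul, norm_mul, norm_pow]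
    have h1 : ‖a‖ * ‖a ^ (m+1) - b ^ (m+1)‖ ≤ ρ * ((m + 1) * ρ ^ m * ‖a - b‖) := by gcongr
    have h2 : ‖b‖ ^ (m+1) * ‖a - b‖ ≤ ρ ^ (m+1) * ‖a - b‖ := by gcongr
    refine (add_le_add h1 h2).trans (le_of_eq ?_)
    push_cast; ring

lemma exists_Q (γ : UnitAddCircle → ℝ) (hcont : Continuous γ) (L : ℝ)
    (hL : ∀ x y, |γ x - γ y| ≤ L * ‖x - y‖) (w : ℝ) (hw : 0 < w)
    (hz : ∀ x : UnitAddCircle, ‖x - ((1/2 : ℝ) : UnitAddCircle)‖ ≤ w → γ x = 0)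
    (c : ℤ → ℝ) (hc : ∀ n, fourierCoeff (fun x => (γ x : ℂ)) n = (c n : ℂ)) (η : ℝ) (hη : 0 < η) :
    ∃ Q : ℤ →₀ ℂ, Q 0 = 1 ∧ (∀ n : ℤ, n < 0 → Q n = 0) ∧
      ∀ n : ℤ, ‖Q.sum fun k z => z * (c (n - k) : ℂ)‖ ≤ η ∧
        (n ≠ 0 → ‖Q.sum fun k z => z * (c (n - k) : ℂ)‖ ≤ η / |(n:ℝ)|) := by
  obtain ⟨κ, hκ1, hκ⟩ := exists_kappa w hw
  obtain ⟨q, hq0, ρ, hρ0, hρ1, hq⟩ := exists_q κ hκ1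
  obtain ⟨Lq, hLq0, hLq⟩ := poly_lip q
  obtain ⟨M, hM⟩ : ∃ M, ∀ x, |γ x| ≤ M := by
    obtain ⟨M, hM⟩ := isCompact_univ.exists_bound_of_continuousOn (f := γ) hcont.continuousOn
    exact ⟨M, fun x => by simpa using hM x trivial⟩
  have hM0 : 0 ≤ M := (abs_nonneg _).trans (hM 0)
  set h : UnitAddCircle := ((1/2 : ℝ) : UnitAddCircle) with hh
  have hL0 : 0 ≤ L := by
    have h1 := hL h 0
    have h2 : ‖h - 0‖ = 1/2 := by
      rw [sub_zero, (AddCircle.norm_coe_eq_abs_iff 1 one_ne_zero).2 (by norm_num [abs_of_pos])]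
      norm_num
    rw [h2] at h1
    linarith [abs_nonneg (γ h - γ 0)]
  set K : ℝ := Lq * (2 * Real.pi) with hK
  have hK0 : 0 ≤ K := by positivity
  -- choose m
  obtain ⟨m, hm1, hm2⟩ : ∃ m : ℕ, M * ρ ^ (m+1) ≤ η ∧
      L * ρ ^ (m+1) + M * ((m + 1) * ρ ^ m * K) ≤ η := by
    have t1 : Filter.Tendsto (fun m : ℕ => ρ ^ m) Filter.atTop (nhds 0) :=
      tendsto_pow_atTop_nhds_zero_of_lt_one hρ0 hρ1
    have t2 : Filter.Tendsto (fun m : ℕ => m * ρ ^ m) Filter.atTop (nhds 0) :=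
      tendsto_self_mul_const_pow_of_lt_one hρ0 hρ1
    have t3 : Filter.Tendsto (fun m : ℕ => ρ ^ (m+1)) Filter.atTop (nhds 0) :=
      (Filter.tendsto_add_atTop_iff_nat 1).2 t1
    have t4 : Filter.Tendsto (fun m : ℕ => M * ρ ^ (m+1)) Filter.atTop (nhds 0) := by
      simpa using t3.const_mul M
    have t5 : Filter.Tendsto (fun m : ℕ => L * ρ ^ (m+1) + M * ((m + 1) * ρ ^ m * K))
        Filter.atTop (nhds 0) := by
      have := (t3.const_mul L).add (((t2.add t1).mul_const K).const_mul M)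
      simp only [mul_zero, zero_mul, add_zero] at this
      refine this.congr fun m => ?_
      ring
    obtain ⟨m, hm⟩ := ((t4.eventually (gt_mem_nhds hη)).and (t5.eventually (gt_mem_nhds hη))).exists
    exact ⟨m, hm.1.le, hm.2.le⟩
  let e : UnitAddCircle → ℂ := fun x => fourier 1 (x - h)
  have he1 : ∀ x, ‖e x‖ = 1 := fun x => by
    change ‖(fourier 1 (x - h) : ℂ)‖ = 1
    rw [fourier_apply]; exact Circle.norm_coe _
  have heneg : ∀ x, e x = - fourier 1 x := by
    intro x
    change (fourier 1 (x - h) : ℂ) = _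
    have := fourier_add_half_inv_index (T := 1) (n := 1) one_ne_zero one_pos (x - h)
    have h3 : ((1 / 2 / ((1 : ℤ):ℝ) : ℝ) : UnitAddCircle) = h := by rw [hh]; simp
    rw [h3, sub_add_cancel] at this
    rw [this, neg_neg]
  let F : UnitAddCircle → ℂ := fun x => (q.eval (e x)) ^ (m+1) * γ x
  have hecont : Continuous e := by
    have := (fourier (T := 1) 1).continuous
    exact this.comp (continuous_id.sub continuous_const)
  have hFcont : Continuous F := by fun_prop
  have hqK : ∀ x, w < ‖x - h‖ → ‖q.eval (e x)‖ ≤ ρ := fun x hx => hq _ (he1 x) (hκ _ hx.le)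
  have hqlip : ∀ x y, ‖q.eval (e x) - q.eval (e y)‖ ≤ K * ‖x - y‖ := by
    intro x y
    refine (hLq _ _ (he1 x).le (he1 y).le).trans ?_
    rw [hK, mul_assoc]
    gcongr
    refine (toCircle_lip _ _).trans (le_of_eq ?_)
    congr 2; abel
  have hFM : ∀ x, ‖F x‖ ≤ η := by
    intro x
    change ‖(q.eval (e x)) ^ (m+1) * (γ x : ℂ)‖ ≤ η
    rcases le_or_gt ‖x - h‖ w with hx | hx
    · rw [hz x hx]; simpa using hη.le
    · rw [norm_mul, norm_pow, Complex.norm_real, Real.norm_eq_abs, mul_comm]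
      refine le_trans ?_ hm1
      have := hqK x hx
      gcongr
      exact hM x
  have hone : ∀ x y, w < ‖x - h‖ → γ y = 0 → ‖F x - F y‖ ≤ η * ‖x - y‖ := by
    intro x y hx hy
    change ‖(q.eval (e x)) ^ (m+1) * (γ x : ℂ) - (q.eval (e y)) ^ (m+1) * (γ y : ℂ)‖ ≤ _
    have h1 := hL x y
    rw [hy, sub_zero] at h1
    rw [hy, Complex.ofReal_zero, mul_zero, sub_zero, norm_mul, norm_pow, Complex.norm_real,
      Real.norm_eq_abs]
    have h2 := hqK x hx
    calc _ ≤ ρ ^ (m+1) * (L * ‖x - y‖) := by gcongr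
      _ = (L * ρ ^ (m+1)) * ‖x - y‖ := by ring
      _ ≤ η * ‖x - y‖ := by
        gcongr
        refine le_trans ?_ hm2
        have : 0 ≤ M * ((m + 1) * ρ ^ m * K) := by positivity
        linarith
  have hFL : ∀ x y, ‖F x - F y‖ ≤ η * ‖x - y‖ := by
    intro x y
    rcases le_or_gt ‖x - h‖ w with hx | hx <;> rcases le_or_gt ‖y - h‖ w with hy | hy
    · simp only [F, hz x hx, hz y hy]; simp; positivity
    · rw [norm_sub_rev, norm_sub_rev x y]; exact hone y x hy (hz x hx)
    · exact hone x y hx (hz y hy)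
    · have e1 : F x - F y = (q.eval (e x)) ^ (m+1) * ((γ x - γ y : ℝ) : ℂ) +
          ((q.eval (e x)) ^ (m+1) - (q.eval (e y)) ^ (m+1)) * (γ y : ℂ) := by
        simp only [F]; push_cast; ring
      rw [e1]
      refine (norm_add_le _ _).trans ?_
      rw [norm_mul, norm_mul, norm_pow, Complex.norm_real, Complex.norm_real,
        Real.norm_eq_abs, Real.norm_eq_abs]
      have h2 := hqK x hx
      have h3 := pow_sub_le ρ _ _ (hqK x hx) (hqK y hy) m
      have h4 : ‖q.eval (e x) ^ (m+1) - q.eval (e y) ^ (m+1)‖ ≤ (m + 1) * ρ ^ m * (K * ‖x - y‖) :=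
        h3.trans (by have := hqlip x y; gcongr)
      calc _ ≤ ρ ^ (m+1) * (L * ‖x - y‖) + ((m + 1) * ρ ^ m * (K * ‖x - y‖)) * M := by
            have := hL x y
            have := hM y
            gcongr
        _ = (L * ρ ^ (m+1) + M * ((m + 1) * ρ ^ m * K)) * ‖x - y‖ := by ring
        _ ≤ η * ‖x - y‖ := by gcongr
  let R : Polynomial ℂ := (q.comp (-Polynomial.X)) ^ (m+1)
  have hR0 : R.coeff 0 = 1 := by
    rw [Polynomial.coeff_zero_eq_eval_zero] at hq0 ⊢
    simp [R, hq0]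
  let Q : ℤ →₀ ℂ := ∑ k ∈ Finset.range (R.natDegree + 1), Finsupp.single (k:ℤ) (R.coeff k)
  have hQsum : ∀ f : ℤ → ℂ, (Q.sum fun k z => z * f k)
      = ∑ k ∈ Finset.range (R.natDegree + 1), R.coeff k * f k := by
    intro f
    simp only [Q]
    rw [← Finsupp.sum_finsetSum_index (by simp) (by intros; ring)]
    refine Finset.sum_congr rfl fun k _ => ?_
    rw [Finsupp.sum_single_index (by simp)]
  have hQfc : ∀ n, (Q.sum fun k z => z * (c (n - k) : ℂ)) = fourierCoeff F n := by
    intro n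
    rw [hQsum (fun k => (c (n - k) : ℂ))]
    have hF : F = fun x => ∑ k ∈ Finset.range (R.natDegree + 1),
        (R.coeff k • fun x => fourier (k:ℤ) x * (γ x : ℂ)) x := by
      ext x
      have : (q.eval (e x)) ^ (m+1) = R.eval (fourier 1 x : ℂ) := by
        simp [R, heneg x, Polynomial.eval_comp]
      change (q.eval (e x)) ^ (m+1) * (γ x : ℂ) = _
      rw [this, Polynomial.eval_eq_sum_range, Finset.sum_mul]
      refine Finset.sum_congr rfl fun k _ => ?_
      have : (fourier (k:ℤ) x : ℂ) = (fourier 1 x : ℂ) ^ k := by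
        simp [fourier_apply, AddCircle.toCircle_nsmul]
      simp only [Pi.smul_apply, smul_eq_mul]
      rw [this]; ring
    rw [hF]
    have hint : ∀ k : ℕ, Integrable (R.coeff k • fun x => fourier (k:ℤ) x * (γ x : ℂ))
        (haarAddCircle (T := 1)) := by
      intro k
      have h1 := (fourier (T := 1) (k:ℤ)).continuous
      have : Continuous (R.coeff k • fun x => fourier (k:ℤ) x * (γ x : ℂ)) := by fun_prop
      exact this.integrable_of_hasCompactSupport (HasCompactSupport.of_compactSpace _)
    have hs := fourierCoeff.sum (T := 1) (Finset.range (R.natDegree + 1))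
      (fun k => (R.coeff k • fun x => fourier (k:ℤ) x * (γ x : ℂ))) (fun k _ => hint k)
    have hs' := congrFun hs n
    rw [Finset.sum_apply] at hs'
    have e6 : (fun x => ∑ k ∈ Finset.range (R.natDegree + 1),
        (R.coeff k • fun x => fourier (k:ℤ) x * (γ x : ℂ)) x) = ∑ k ∈ Finset.range (R.natDegree + 1),
        (R.coeff k • fun x : UnitAddCircle => fourier (k:ℤ) x * (γ x : ℂ)) := by
      ext x; simp
    rw [e6, hs']
    refine Finset.sum_congr rfl fun k _ => ?_
    rw [fourierCoeff.const_smul, fc_mul_fourier, hc, smul_eq_mul]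
  refine ⟨Q, ?_, ?_, ?_⟩
  · simp only [Q, Finsupp.finsetSum_apply, Finsupp.single_apply]
    simp [hR0]
  · intro n hn
    simp only [Q, Finsupp.finsetSum_apply, Finsupp.single_apply]
    refine Finset.sum_eq_zero fun k _ => ?_
    rw [if_neg]; omega
  · intro n
    rw [hQfc]
    exact ⟨fc_bound F η hFM n, fun hn => fc_decay F hFcont η hFL n hn⟩

lemma fc_one (n : ℤ) : fourierCoeff (fun _ : UnitAddCircle => (1:ℂ)) n = if n = 0 then 1 else 0 := by
  have h := fourierCoeff_fourier (T := 1) 0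
  have h2 : ((fourier 0 : C(UnitAddCircle, ℂ)) : UnitAddCircle → ℂ) = fun _ => (1:ℂ) := by
    ext x; simp
  rw [h2] at h
  rw [h, Pi.single_apply]

/-- The nonnegative function with nonnegative coefficients vanishing near `1/2`. -/
noncomputable def gam (w : ℝ) (x : UnitAddCircle) : ℝ :=
  1 + 2 * tri (2*w) x + tri w x - 2 * tri (2*w) (x - ((1/2:ℝ) : UnitAddCircle))
    + tri w (x - ((1/2:ℝ) : UnitAddCircle))

noncomputable def gamC (w : ℝ) (n : ℤ) : ℝ :=
  (if n = 0 then 1 else 0) + 2 * triC (2*w) n + triC w n - 2 * (Real.cos (Real.pi * n) * triC (2*w) n)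
    + Real.cos (Real.pi * n) * triC w n

lemma tri_nonneg (w : ℝ) (x : UnitAddCircle) : 0 ≤ tri w x := le_max_left _ _

lemma trap_le (w : ℝ) (hw : 0 < w) (x : UnitAddCircle) : 2 * tri (2*w) x - tri w x ≤ 1 := by
  unfold tri
  have e : ‖x‖ / (2*w) = ‖x‖ / w / 2 := by field_simp
  rw [e]
  have : 0 ≤ ‖x‖ / w := by positivity
  generalize ‖x‖ / w = a at *
  rcases max_cases 0 (1 - a/2) with h | h <;> rcases max_cases 0 (1 - a) with h' | h' <;> linarith

lemma trap_eq (w : ℝ) (hw : 0 < w) (x : UnitAddCircle) (hx : ‖x‖ ≤ w) :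
    2 * tri (2*w) x - tri w x = 1 := by
  unfold tri
  have e : ‖x‖ / (2*w) = ‖x‖ / w / 2 := by field_simp
  rw [e]
  have : ‖x‖ / w ≤ 1 := (div_le_one hw).2 hx
  generalize ‖x‖ / w = a at *
  rw [max_eq_right (by linarith), max_eq_right (by linarith)]
  ring

lemma tri_zero (w : ℝ) (hw : 0 < w) (x : UnitAddCircle) (hx : w ≤ ‖x‖) : tri w x = 0 := by
  unfold tri
  have : 1 ≤ ‖x‖ / w := (one_le_div hw).2 hx
  exact max_eq_left (by linarith)

lemma gam_nonneg (w : ℝ) (hw : 0 < w) (x : UnitAddCircle) : 0 ≤ gam w x := by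
  unfold gam
  linarith [trap_le w hw (x - ((1/2:ℝ) : UnitAddCircle)), tri_nonneg w x, tri_nonneg (2*w) x]

lemma gam_zero (w : ℝ) (hw : 0 < w) (hw6 : w ≤ 1/6) (x : UnitAddCircle)
    (hx : ‖x - ((1/2:ℝ) : UnitAddCircle)‖ ≤ w) : gam w x = 0 := by
  have h2 : ‖((1/2 : ℝ) : UnitAddCircle)‖ = 1/2 := by
    rw [(AddCircle.norm_coe_eq_abs_iff 1 one_ne_zero).2 (by norm_num [abs_of_pos])]
    norm_num
  have h3 : 1/2 - w ≤ ‖x‖ := by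
    have := norm_sub_norm_le ((1/2 : ℝ) : UnitAddCircle) x
    rw [norm_sub_rev, h2] at this
    linarith
  unfold gam
  rw [tri_zero w hw x (by linarith), tri_zero (2*w) (by linarith) x (by linarith)]
  linarith [trap_eq w hw _ hx]

lemma gam_cont (w : ℝ) : Continuous (gam w) := by
  have := tri_cont w
  have := tri_cont (2*w)
  unfold gam
  fun_prop

lemma gam_lip (w : ℝ) (hw : 0 < w) (x y : UnitAddCircle) :
    |gam w x - gam w y| ≤ (6 / w) * ‖x - y‖ := by
  set h := ((1/2:ℝ) : UnitAddCircle) with hh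
  have e : x - h - (y - h) = x - y := by abel
  have h1 := abs_le.1 (tri_lip w hw x y)
  have h2 := abs_le.1 (tri_lip (2*w) (by linarith) x y)
  have h3 := abs_le.1 (tri_lip w hw (x-h) (y-h))
  have h4 := abs_le.1 (tri_lip (2*w) (by linarith) (x-h) (y-h))
  rw [e] at h3 h4
  have e2 : 1 / (2*w) * ‖x - y‖ = (1 / w * ‖x - y‖) / 2 := by field_simp
  have e3 : 6 / w * ‖x - y‖ = 6 * (1 / w * ‖x - y‖) := by ring
  rw [e2] at h2 h4
  rw [e3]
  have : 0 ≤ 1 / w * ‖x - y‖ := by positivity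
  generalize 1 / w * ‖x - y‖ = a at *
  unfold gam
  rw [← hh]
  rw [abs_le]
  constructor <;> linarith [h1.1, h1.2, h2.1, h2.2, h3.1, h3.2, h4.1, h4.2]

lemma fourier_half (n : ℤ) :
    (fourier (-n) ((1/2:ℝ) : UnitAddCircle) : ℂ) = (Real.cos (Real.pi * n) : ℂ) := by
  rw [fourier_coe_apply]
  have : 2 * (Real.pi:ℂ) * Complex.I * ((-n : ℤ):ℂ) * ((1/2:ℝ):ℂ) / ((1:ℝ):ℂ)
    = ((-(Real.pi * n) : ℝ) : ℂ) * Complex.I := by push_cast; ring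
  rw [this, Complex.exp_mul_I, ← Complex.ofReal_cos, ← Complex.ofReal_sin, Real.cos_neg,
    Real.sin_neg, mul_comm Real.pi, Real.sin_int_mul_pi]
  simp

lemma gam_fc (w : ℝ) (hw : 0 < w) (hw6 : w ≤ 1/6) (n : ℤ) :
    fourierCoeff (fun x => (gam w x : ℂ)) n = (gamC w n : ℂ) := by
  set h : UnitAddCircle := ((1/2:ℝ) : UnitAddCircle) with hh
  have hi : ∀ f : UnitAddCircle → ℂ, Continuous f → Integrable f (haarAddCircle (T := 1)) :=
    fun f hf => hf.integrable_of_hasCompactSupport (HasCompactSupport.of_compactSpace _)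
  have c1 := tri_cont w
  have c2 := tri_cont (2*w)
  let f0 : UnitAddCircle → ℂ := fun _ => 1
  let f1 : UnitAddCircle → ℂ := fun x => (tri (2*w) x : ℂ)
  let f2 : UnitAddCircle → ℂ := fun x => (tri w x : ℂ)
  let f3 : UnitAddCircle → ℂ := fun x => f1 (x - h)
  let f4 : UnitAddCircle → ℂ := fun x => f2 (x - h)
  have d1 : Continuous f1 := by fun_prop
  have d2 : Continuous f2 := by fun_prop
  have d3 : Continuous f3 := by fun_prop
  have d4 : Continuous f4 := by fun_prop
  have e : (fun x => (gam w x : ℂ)) = f0 + (2:ℂ) • f1 + f2 + (-2:ℂ) • f3 + f4 := by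
    ext x
    simp [f0, f1, f2, f3, f4, gam]
    rw [hh]
    ring
  have d0 : Continuous f0 := continuous_const
  have g1 : Continuous ((2:ℂ) • f1) := d1.const_smul _
  have g3 : Continuous ((-2:ℂ) • f3) := d3.const_smul _
  rw [e, fourierCoeff.add (hi _ (((d0.add g1).add d2).add g3)) (hi _ d4),
    fourierCoeff.add (hi _ ((d0.add g1).add d2)) (hi _ g3),
    fourierCoeff.add (hi _ (d0.add g1)) (hi _ d2),
    fourierCoeff.add (hi _ d0) (hi _ g1)]
  simp only [Pi.add_apply, fourierCoeff.const_smul]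
  have k3 : fourierCoeff f3 n = _ := fc_shift f1 h n
  have k4 : fourierCoeff f4 n = _ := fc_shift f2 h n
  have k1 : fourierCoeff f1 n = _ := tri_fc (2*w) (by linarith) (by linarith) n
  have k2 : fourierCoeff f2 n = _ := tri_fc w hw (by linarith) n
  have k0 : fourierCoeff f0 n = _ := fc_one n
  rw [k3, k4, k1, k2, k0, hh, fourier_half]
  simp [gamC]
  split_ifs <;> simp <;> ring

lemma gamC_nonneg (w : ℝ) (hw : 0 < w) (n : ℤ) : (if n = 0 then 1 else 0) ≤ gamC w n := by
  unfold gamC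
  have h1 := triC_nonneg w hw n
  have h2 := triC_nonneg (2*w) (by linarith) n
  have h3 := Real.cos_le_one (Real.pi * n)
  have h4 := Real.neg_one_le_cos (Real.pi * n)
  nlinarith [mul_nonneg h1 (sub_nonneg.2 h4), mul_nonneg h2 (sub_nonneg.2 h3)]

lemma gamC_le (w : ℝ) (hw : 0 < w) (n : ℤ) :
    gamC w n ≤ (if n = 0 then 1 else 0) + (4 * triC (2*w) n + 2 * triC w n) := by
  unfold gamC
  have h1 := triC_nonneg w hw n
  have h2 := triC_nonneg (2*w) (by linarith) n
  have h3 := Real.cos_le_one (Real.pi * n)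
  have h4 := Real.neg_one_le_cos (Real.pi * n)
  nlinarith [mul_nonneg h1 (sub_nonneg.2 h3), mul_nonneg h2 (sub_nonneg.2 h4)]

lemma gamC_even (w : ℝ) (n : ℤ) : gamC w (-n) = gamC w n := by
  simp [gamC, triC]

lemma exists_gamma (p : ℝ) (hp : 1 < p) (ε : ℝ) (hε : 0 < ε) :
    ∃ (γ : C(UnitAddCircle, ℝ)) (L w : ℝ) (c : ℤ → ℝ), (∀ x y, |γ x - γ y| ≤ L * ‖x - y‖) ∧ 0 < w ∧
      (∀ x : UnitAddCircle, ‖x - ((1/2 : ℝ) : UnitAddCircle)‖ ≤ w → γ x = 0) ∧ (∀ x, 0 ≤ γ x) ∧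
      (∀ n, fourierCoeff (fun x => (γ x : ℂ)) n = (c n : ℂ)) ∧ (∀ n, 0 ≤ c n) ∧ 1 ≤ c 0 ∧ (∀ n, c (-n) = c n) ∧
      Summable c ∧
      ∀ s : Finset ℤ, 0 ∉ s → ∑ n ∈ s, c n ^ p ≤ ε := by
  obtain ⟨w, hw0, hw6, hw⟩ : ∃ w : ℝ, 0 < w ∧ w ≤ 1/6 ∧ (10 * w) ^ (p - 1) * 6 ≤ ε := by
    have hcont : Continuous fun w : ℝ => (10 * w) ^ (p - 1) * 6 := by
      have := Real.continuous_rpow_const (q := p - 1) (by linarith)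
      exact (this.comp (continuous_const_mul 10)).mul continuous_const
    have t : Filter.Tendsto (fun w : ℝ => (10 * w) ^ (p - 1) * 6) (nhdsWithin 0 (Set.Ioi 0)) (nhds 0) := by
      have := (hcont.tendsto 0).mono_left (nhdsWithin_le_nhds (s := Set.Ioi 0))
      simpa [Real.zero_rpow (by linarith : p - 1 ≠ 0)] using this
    have a1 := t.eventually (gt_mem_nhds hε)
    have a2 : ∀ᶠ w : ℝ in nhdsWithin 0 (Set.Ioi 0), w ∈ Set.Ioc (0:ℝ) (1/6) :=
      Ioc_mem_nhdsGT (by norm_num)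
    obtain ⟨w, h1, h2⟩ := (a1.and a2).exists
    exact ⟨w, h2.1, h2.2, h1.le⟩
  have hs1 := triC_summable w hw0
  have hs2 := triC_summable (2*w) (by linarith)
  have hc0 : ∀ n, 0 ≤ gamC w n := fun n => by
    refine le_trans ?_ (gamC_nonneg w hw0 n); split_ifs <;> norm_num
  refine ⟨⟨gam w, gam_cont w⟩, 6 / w, w, gamC w, gam_lip w hw0, hw0, gam_zero w hw0 hw6,
    gam_nonneg w hw0, gam_fc w hw0 hw6, hc0, by simpa using gamC_nonneg w hw0 0, gamC_even w, ?_, ?_⟩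
  · refine Summable.of_nonneg_of_le hc0 (gamC_le w hw0) ?_
    refine Summable.add ?_ ((hs2.mul_left 4).add (hs1.mul_left 2))
    exact (hasSum_ite_eq 0 (1:ℝ)).summable
  · intro s hs
    have hb : ∀ n ∈ s, gamC w n ^ p ≤ (10 * w) ^ (p - 1) * (4 * triC (2*w) n + 2 * triC w n) := by
      intro n hn
      have hn0 : n ≠ 0 := fun h => hs (h ▸ hn)
      have h1 := gamC_le w hw0 n
      rw [if_neg hn0, zero_add] at h1
      have h2 : gamC w n ≤ 10 * w := by
        linarith [triC_le w hw0 n, triC_le (2*w) (by linarith) n]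
      have h3 : gamC w n ^ p = gamC w n ^ (p - 1) * gamC w n := by
        rcases (hc0 n).eq_or_lt with h | h
        · rw [← h, mul_zero, Real.zero_rpow (by linarith)]
        · rw [Real.rpow_sub_one h.ne']; field_simp
      rw [h3]
      have h0 := hc0 n
      have h5 : 0 ≤ p - 1 := by linarith
      gcongr
    refine (Finset.sum_le_sum hb).trans ?_
    rw [← Finset.mul_sum, Finset.sum_add_distrib, ← Finset.mul_sum, ← Finset.mul_sum]
    refine le_trans ?_ hw
    have t1 := triC_sum w hw0 (by linarith) s
    have t2 := triC_sum (2*w) (by linarith) (by linarith) s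
    gcongr
    linarith

lemma apNorm_lt (p : ℝ) (hp : 1 < p) (ε : ℝ) (hε : 0 < ε) (x : ℤ →₀ ℂ)
    (h : ∑ n ∈ x.support, ‖x n‖ ^ p < ε ^ p) : apNormZ p x < ε := by
  unfold apNormZ
  have h0 : 0 ≤ ∑ n ∈ x.support, ‖x n‖ ^ p := by positivity
  calc (x.sum fun _ z => ‖z‖ ^ p) ^ (1 / p) < (ε ^ p) ^ (1 / p) :=
        Real.rpow_lt_rpow h0 h (by positivity)
    _ = ε := by rw [one_div, Real.rpow_rpow_inv hε.le (by linarith)]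

lemma trig_sub (b c : ℤ →₀ ℂ) (t : ℝ) : trigPolyZ (b - c) t = trigPolyZ b t - trigPolyZ c t := by
  unfold trigPolyZ
  exact Finsupp.sum_sub_index (by intros; ring)

lemma trig_one (t : ℝ) : trigPolyZ (Finsupp.single 0 1) t = 1 := by
  unfold trigPolyZ
  rw [Finsupp.sum_single_index (by simp)]
  simp

/-- Convolution. -/
noncomputable def convZ (Q c : ℤ →₀ ℂ) : ℤ →₀ ℂ :=
  Q.sum fun k z => c.sum fun n v => Finsupp.single (k + n) (z * v)

lemma trig_conv (Q c : ℤ →₀ ℂ) (t : ℝ) : trigPolyZ (convZ Q c) t = trigPolyZ Q t * trigPolyZ c t := by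
  unfold trigPolyZ convZ
  rw [Finsupp.sum_sum_index (by simp) (by intros; ring), Finsupp.sum_mul]
  refine Finsupp.sum_congr fun k _ => ?_
  rw [Finsupp.sum_sum_index (by simp) (by intros; ring), Finsupp.mul_sum]
  refine Finsupp.sum_congr fun n _ => ?_
  rw [Finsupp.sum_single_index (by simp)]
  have : 2 * (Real.pi:ℂ) * Complex.I * ((k + n : ℤ):ℂ) * t =
    2 * Real.pi * Complex.I * k * t + 2 * Real.pi * Complex.I * n * t := by push_cast; ring
  rw [this, Complex.exp_add]
  ring

lemma conv_apply (Q c : ℤ →₀ ℂ) (n : ℤ) :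
    convZ Q c n = Q.sum fun k z => z * c (n - k) := by
  unfold convZ
  rw [Finsupp.sum_apply]
  refine Finsupp.sum_congr fun k _ => ?_
  rw [Finsupp.sum_apply]
  simp only [Finsupp.single_apply]
  rw [Finsupp.sum, Finset.sum_eq_single (n - k)]
  · simp
  · intro m _ hm
    rw [if_neg]; intro h; apply hm; omega
  · intro h
    simp [Finsupp.notMem_support_iff.1 h]

theorem exists_analytic_P_and_positive_gamma
    (p : ℝ) (hp : 1 < p) (ε : ℝ) (hε : 0 < ε) :
    ∃ b c : ℤ →₀ ℂ,
      (∀ t : ℝ, (trigPolyZ c t).im = 0 ∧ 0 < (trigPolyZ c t).re) ∧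
      c 0 = 1 ∧
      (∀ n : ℤ, (c n).im = 0 ∧ 0 ≤ (c n).re) ∧
      apNormZ p (c - Finsupp.single 0 1) < ε ∧
      (∀ n : ℕ, b (-(n : ℤ)) = 0) ∧
      (∃ d : ℤ →₀ ℂ,
        (∀ t : ℝ, trigPolyZ d t = trigPolyZ b t * trigPolyZ c t) ∧
        apNormZ p (d - Finsupp.single 0 1) < ε) := by
  have hp0 : 0 < p := by linarith
  set ε₁ : ℝ := ε ^ p / (3 ^ p * 4) with hε₁
  have h3p : (1:ℝ) ≤ 3 ^ p := Real.one_le_rpow (by norm_num) hp0.le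
  have hε₁0 : 0 < ε₁ := by positivity
  have hεp : 3 ^ p * (4 * ε₁) = ε ^ p := by rw [hε₁]; field_simp
  have hεp' : ε₁ < ε ^ p := by rw [← hεp]; nlinarith
  obtain ⟨γ, L, w, c, hL, hw, hz, hγ0, hfc, hc0, hc1, hceven, hcs, hcp⟩ :=
    exists_gamma p hp ε₁ hε₁0
  -- the constant S
  have hS := Real.summable_abs_int_rpow hp
  set S : ℝ := 1 + ∑' n : ℤ, |(n:ℝ)| ^ (-p) with hSdef
  have hS0 : 0 < S := by
    have : 0 ≤ ∑' n : ℤ, |(n:ℝ)| ^ (-p) := tsum_nonneg fun n => by positivity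
    linarith
  set η : ℝ := (ε₁ / S) ^ (1 / p) with hη
  have hη0 : 0 < η := by positivity
  have hηp : η ^ p * S = ε₁ := by
    rw [hη, one_div, Real.rpow_inv_rpow (by positivity) hp0.ne']
    field_simp
  obtain ⟨Q, hQ0, hQneg, hQ⟩ := exists_Q γ γ.continuous L hL w hw hz c hfc η hη0
  set q : ℤ → ℂ := fun n => Q.sum fun k z => z * (c (n - k) : ℂ) with hq
  have hqsum : ∀ s : Finset ℤ, ∑ n ∈ s, ‖q n‖ ^ p ≤ ε₁ := by
    intro s
    have h1 : ∀ n ∈ s, ‖q n‖ ^ p ≤ η ^ p * ((if n = 0 then 1 else 0) + |(n:ℝ)| ^ (-p)) := by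
      intro n _
      split_ifs with hn
      · have : ‖q n‖ ^ p ≤ η ^ p := Real.rpow_le_rpow (norm_nonneg _) (hQ n).1 hp0.le
        have h2 : 0 ≤ |(n:ℝ)| ^ (-p) := by positivity
        have h3 : 0 < η ^ p := by positivity
        nlinarith
      · have := Real.rpow_le_rpow (norm_nonneg _) ((hQ n).2 hn) hp0.le
        rw [Real.div_rpow hη0.le (abs_nonneg _)] at this
        rw [zero_add, Real.rpow_neg (abs_nonneg _), ← div_eq_mul_inv]
        exact this
    refine (Finset.sum_le_sum h1).trans ?_
    rw [← Finset.mul_sum, ← hηp, Finset.sum_add_distrib]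
    have h4 : ∑ n ∈ s, (if n = 0 then (1:ℝ) else 0) ≤ 1 := by
      rw [Finset.sum_ite_eq']; split_ifs <;> norm_num
    have h5 : ∑ n ∈ s, |(n:ℝ)| ^ (-p) ≤ ∑' n : ℤ, |(n:ℝ)| ^ (-p) :=
      hS.sum_le_tsum s (fun n _ => by positivity)
    gcongr
    linarith
  -- delta
  set B : ℝ := Q.sum fun _ z => ‖z‖ with hB
  have hB0 : 0 ≤ B := Finset.sum_nonneg fun _ _ => norm_nonneg _
  set δ : ℝ := min ε₁ 1 / (2 * (B + 1)) with hδ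
  have hm0 : 0 < min ε₁ 1 := lt_min hε₁0 one_pos
  have hδ0 : 0 < δ := by positivity
  have hδB : B * (2 * δ) ≤ min ε₁ 1 := by
    have : 2 * δ * (B + 1) = min ε₁ 1 := by rw [hδ]; field_simp
    nlinarith
  obtain ⟨s₀, hs₀⟩ := summable_iff_vanishing_norm.1 hcs (δ/2) (by positivity)
  set N : ℤ := ((s₀.sup Int.natAbs : ℕ) : ℤ) with hN
  set I : Finset ℤ := Finset.Icc (-N) N with hI
  have hs₀I : s₀ ⊆ I := by
    intro n hn
    have := Finset.le_sup (f := Int.natAbs) hn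
    rw [hI, Finset.mem_Icc]
    omega
  have hN0 : 0 ≤ N := by positivity
  have h0I : (0:ℤ) ∈ I := by rw [hI, Finset.mem_Icc]; omega
  have hIneg : ∀ n, -n ∈ I ↔ n ∈ I := by intro n; rw [hI, Finset.mem_Icc, Finset.mem_Icc]; omega
  have htail : ∀ s : Finset ℤ, Disjoint s I → ∑ n ∈ s, c n ≤ δ / 2 := by
    intro s hs
    have := hs₀ s (hs.mono_right hs₀I)
    exact ((le_abs_self _).trans_lt this).le
  set A : ℝ := c 0 + δ with hA
  have hA1 : 1 ≤ A := by linarith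
  have hA0 : 0 < A := by linarith
  let u : ℤ → ℝ := fun n => if n ∈ I then (if n = 0 then 1 else c n / A) else 0
  have hu0 : u 0 = 1 := by simp [u, h0I]
  have hunn : ∀ n, 0 ≤ u n := by
    intro n
    simp only [u]
    split_ifs
    · norm_num
    · exact div_nonneg (hc0 n) hA0.le
    · exact le_rfl
  have hule : ∀ n, n ≠ 0 → u n ≤ c n := by
    intro n hn
    simp only [u, if_neg hn]
    split_ifs
    · exact div_le_self (hc0 n) hA1
    · exact hc0 n
  have hueven : ∀ n, u (-n) = u n := by
    intro n; simp only [u, hIneg, neg_eq_zero, hceven]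
  let c' : ℤ →₀ ℂ := Finsupp.onFinset I (fun n => (u n : ℂ)) (by
    intro n hn
    by_contra h
    exact hn (by simp [u, h]))
  have hc' : ∀ n, c' n = (u n : ℂ) := fun n => rfl
  have htrig : ∀ t : ℝ, trigPolyZ c' t = ∑ n ∈ I, (u n : ℂ) * (fourier n (t : UnitAddCircle) : ℂ) := by
    intro t
    unfold trigPolyZ
    simp only [c']
    rw [Finsupp.onFinset_sum _ (by simp)]
    refine Finset.sum_congr rfl fun n _ => ?_
    rw [fourier_coe_apply]; simp
  -- coefficients of the centered polynomial
  have hc'1 : ∀ n, ‖(c' - Finsupp.single 0 1 : ℤ →₀ ℂ) n‖ = if n = 0 then 0 else u n := by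
    intro n
    rw [Finsupp.sub_apply, hc', Finsupp.single_apply]
    split_ifs with h1 h2 h2
    · simp [h2, hu0]
    · exact absurd h1.symm h2
    · exact absurd h2.symm h1
    · simp [abs_of_nonneg (hunn n)]
  have hc'p : ∀ s : Finset ℤ, ∑ n ∈ s, ‖(c' - Finsupp.single 0 1 : ℤ →₀ ℂ) n‖ ^ p ≤ ε₁ := by
    intro s
    refine le_trans ?_ (hcp (s.erase 0) (Finset.notMem_erase _ _))
    rw [← Finset.sum_erase (a := 0) s (by rw [hc'1]; simp [hp0.ne'])]
    refine Finset.sum_le_sum fun n hn => ?_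
    have hn0 := (Finset.mem_erase.1 hn).1
    rw [hc'1, if_neg hn0]
    exact Real.rpow_le_rpow (hunn n) (hule n hn0) hp0.le
  -- remainder
  let r : ℤ → ℝ := fun n => A * u n - c n
  have hr : ∀ s : Finset ℤ, ∑ n ∈ s, |r n| ≤ 2 * δ := by
    intro s
    have h1 : ∀ n ∈ s, |r n| ≤ (if n = 0 then δ else 0) + (if n ∈ I then 0 else c n) := by
      intro n _
      by_cases hn : n = 0
      · subst hn
        simp only [r, hu0, if_pos h0I, if_true, hA]
        rw [mul_one, add_sub_cancel_left, abs_of_pos hδ0, add_zero]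
      · by_cases hnI : n ∈ I
        · simp only [r, u, if_pos hnI, if_neg hn]
          rw [mul_div_cancel₀ _ hA0.ne']; simp
        · simp only [r, u, if_neg hnI, if_neg hn]
          simp [abs_of_nonneg (hc0 n)]
    refine (Finset.sum_le_sum h1).trans ?_
    rw [Finset.sum_add_distrib, Finset.sum_ite_eq']
    have h2 : ∑ n ∈ s, (if n ∈ I then 0 else c n) ≤ δ / 2 := by
      have e : ∑ n ∈ s, (if n ∈ I then 0 else c n) = ∑ n ∈ s.filter (· ∉ I), c n := by
        rw [Finset.sum_filter]
        refine Finset.sum_congr rfl fun n _ => ?_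
        by_cases h : n ∈ I <;> simp [h]
      rw [e]
      refine htail _ ?_
      rw [Finset.disjoint_left]
      intro n hn; exact (Finset.mem_filter.1 hn).2
    split_ifs <;> linarith
  let y : ℤ → ℝ := fun n => Q.sum fun k z => ‖z‖ * |r (n - k)|
  have hy0 : ∀ n, 0 ≤ y n := fun n => Finset.sum_nonneg fun _ _ => by positivity
  have hysum : ∀ s : Finset ℤ, ∑ n ∈ s, y n ≤ min ε₁ 1 := by
    intro s
    refine le_trans ?_ hδB
    simp only [y, Finsupp.sum]
    rw [Finset.sum_comm, hB, Finsupp.sum, Finset.sum_mul]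
    refine Finset.sum_le_sum fun k _ => ?_
    rw [← Finset.mul_sum]
    gcongr
    have := hr (s.image fun n => n - k)
    rwa [Finset.sum_image (by intro a _ b _ h; simpa using h)] at this
  have hyp : ∀ s : Finset ℤ, ∑ n ∈ s, y n ^ p ≤ ε₁ := by
    intro s
    refine le_trans (Finset.sum_le_sum fun n _ => ?_) ((hysum s).trans (min_le_left _ _))
    have h1 : y n ≤ 1 := by
      have := (hysum {n}).trans (min_le_right _ _)
      simpa using this
    exact Real.rpow_le_self_of_le_one (hy0 n) h1 hp.le
  have hg : ∀ n, ‖convZ Q c' n‖ ≤ ‖q n‖ + y n := by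
    intro n
    have e : (A:ℂ) * convZ Q c' n = q n + Q.sum fun k z => z * (r (n - k) : ℂ) := by
      rw [conv_apply, hq]
      simp only [Finsupp.sum]
      rw [Finset.mul_sum, ← Finset.sum_add_distrib]
      refine Finset.sum_congr rfl fun k _ => ?_
      simp only [hc', r]
      push_cast; ring
    have h1 : ‖convZ Q c' n‖ ≤ ‖(A:ℂ) * convZ Q c' n‖ := by
      rw [norm_mul, Complex.norm_real, Real.norm_of_nonneg hA0.le]
      exact le_mul_of_one_le_left (norm_nonneg _) hA1
    refine h1.trans ?_
    rw [e]
    refine (norm_add_le _ _).trans ?_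
    gcongr
    refine (norm_sum_le _ _).trans (le_of_eq ?_)
    refine Finset.sum_congr rfl fun k _ => ?_
    rw [norm_mul, Complex.norm_real, Real.norm_eq_abs]
  refine ⟨Finsupp.single 0 1 - Q, c', ?_, by rw [hc', hu0]; simp, ?_, ?_, ?_,
    c' - convZ Q c', ?_, ?_⟩
  · intro t
    rw [htrig]
    constructor
    · rw [Complex.im_sum]
      have e : ∑ n ∈ I, ((u n : ℂ) * (fourier n (t : UnitAddCircle) : ℂ)).im
          = ∑ n ∈ I, - ((u n : ℂ) * (fourier n (t : UnitAddCircle) : ℂ)).im := by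
        refine Finset.sum_equiv (Equiv.neg ℤ) (by intro n; simp [hIneg]) ?_
        intro n _
        rw [Equiv.neg_apply, hueven, fourier_neg, Complex.im_ofReal_mul, Complex.im_ofReal_mul, Complex.conj_im]
        ring
      rw [Finset.sum_neg_distrib] at e
      linarith
    · let f : C(UnitAddCircle, ℂ) := ⟨fun x => (γ x : ℂ), by fun_prop⟩
      have hfs : Summable (fourierCoeff f) := by
        have : fourierCoeff f = fun n => (c n : ℂ) := funext hfc
        rw [this]; exact_mod_cast hcs
      have hsum := has_pointwise_sum_fourier_series_of_summable hfs (t : UnitAddCircle)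
      have hfc' : ∀ n, fourierCoeff f n = (c n : ℂ) := hfc
      simp only [hfc', smul_eq_mul] at hsum
      set Z : ℂ := ∑ n ∈ I, (c n : ℂ) * (fourier n (t : UnitAddCircle) : ℂ) with hZ
      have hclose : ‖f t - Z‖ ≤ δ / 2 := by
        refine le_of_tendsto (hsum.sub_const Z).norm ?_
        filter_upwards [Filter.eventually_ge_atTop I] with s hs
        rw [hZ, ← Finset.sum_sdiff hs, add_sub_cancel_right]
        refine (norm_sum_le _ _).trans ?_
        refine le_trans (le_of_eq ?_) (htail (s \ I) Finset.sdiff_disjoint)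
        refine Finset.sum_congr rfl fun n _ => ?_
        have : ‖(fourier n (t : UnitAddCircle) : ℂ)‖ = 1 := by
          rw [fourier_apply]; exact Circle.norm_coe _
        rw [norm_mul, this, mul_one, Complex.norm_real, Real.norm_of_nonneg (hc0 n)]
      have eA : (A:ℂ) * ∑ n ∈ I, (u n : ℂ) * (fourier n (t : UnitAddCircle) : ℂ) = δ + Z := by
        rw [Finset.mul_sum, hZ, ← Finset.add_sum_erase _ _ h0I, ← Finset.add_sum_erase _ _ h0I,
          ← add_assoc]
        congr 1
        · rw [hu0, hA]; simp; ring
        · refine Finset.sum_congr rfl fun n hn => ?_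
          have hn' := Finset.mem_erase.1 hn
          simp only [u, if_pos hn'.2, if_neg hn'.1]
          have : (A:ℂ) ≠ 0 := by exact_mod_cast hA0.ne'
          push_cast
          field_simp
      have hre : A * (∑ n ∈ I, (u n : ℂ) * (fourier n (t : UnitAddCircle) : ℂ)).re = δ + Z.re := by
        have := congrArg Complex.re eA
        rwa [Complex.re_ofReal_mul, Complex.add_re, Complex.ofReal_re] at this
      have h1 := (Complex.abs_re_le_norm (f t - Z)).trans hclose
      have h2 := (abs_le.1 h1).2
      have h3 : (f t).re = γ t := Complex.ofReal_re _
      rw [Complex.sub_re, h3] at h2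
      have h4 := hγ0 t
      have h5 : 0 < δ + Z.re := by linarith
      rw [← hre] at h5
      exact (pos_iff_pos_of_mul_pos h5).1 hA0
  · intro n
    rw [hc']
    exact ⟨Complex.ofReal_im _, by rw [Complex.ofReal_re]; exact hunn n⟩
  · exact apNorm_lt p hp ε hε _ ((hc'p _).trans_lt hεp')
  · intro n
    rw [Finsupp.sub_apply, Finsupp.single_apply]
    rcases Nat.eq_zero_or_pos n with h | h
    · subst h; simp [hQ0]
    · rw [hQneg _ (by omega), if_neg (by omega), sub_zero]
  · intro t
    rw [trig_sub, trig_sub, trig_one, trig_conv]; ring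
  · apply apNorm_lt p hp ε hε
    set x : ℤ →₀ ℂ := c' - convZ Q c' - Finsupp.single 0 1 with hx
    have hb : ∀ n ∈ x.support, ‖x n‖ ^ p ≤ 3 ^ p *
        (‖(c' - Finsupp.single 0 1 : ℤ →₀ ℂ) n‖ ^ p + ‖q n‖ ^ p + y n ^ p) := by
      intro n _
      have e : x n = (c' - Finsupp.single 0 1 : ℤ →₀ ℂ) n - convZ Q c' n := by
        rw [hx]; simp only [Finsupp.sub_apply]; ring
      have h1 : ‖x n‖ ≤ ‖(c' - Finsupp.single 0 1 : ℤ →₀ ℂ) n‖ + (‖q n‖ + y n) := by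
        rw [e]; exact (norm_sub_le _ _).trans (by gcongr; exact hg n)
      have ha := norm_nonneg ((c' - Finsupp.single 0 1 : ℤ →₀ ℂ) n)
      have hb := norm_nonneg (q n)
      have hc := hy0 n
      generalize ‖(c' - Finsupp.single 0 1 : ℤ →₀ ℂ) n‖ = a at *
      generalize ‖q n‖ = b at *
      generalize y n = d at *
      have h2 : ∀ m, 0 ≤ m → ‖x n‖ ≤ 3 * m → ‖x n‖ ^ p ≤ 3 ^ p * m ^ p := by
        intro m hm h
        rw [← Real.mul_rpow (by norm_num) hm]
        exact Real.rpow_le_rpow (norm_nonneg _) h hp0.le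
      have a1 : 0 ≤ a ^ p := by positivity
      have a2 : 0 ≤ b ^ p := by positivity
      have a3 : 0 ≤ d ^ p := by positivity
      rcases le_total a b with hab | hab <;> rcases le_total b d with hbd | hbd <;>
        rcases le_total a d with had | had
      all_goals first
        | exact (h2 a ha (by linarith)).trans (by gcongr; linarith)
        | exact (h2 b hb (by linarith)).trans (by gcongr; linarith)
        | exact (h2 d hc (by linarith)).trans (by gcongr; linarith)
    refine (Finset.sum_le_sum hb).trans_lt ?_
    rw [← Finset.mul_sum, Finset.sum_add_distrib, Finset.sum_add_distrib, ← hεp]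
    have g1 := hc'p x.support
    have g2 := hqsum x.support
    have g3 := hyp x.support
    have : (0:ℝ) < 3 ^ p := by positivity
    gcongr
    linarith
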